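/- Let P be a left cancellative monoid and suppose there exists a nonzero character (unital *-homomorphism to ℂ) χ on the C*-algebra C*_r(P) generated by the isometries {V_p : p ∈ P} on ℓ²(P). Then P is left amenable, i.e., there exists a left invariant mean on ℓ∞(P). -/

import Mathlib

open scoped ENNReal

noncomputable section

/-- The left translate `f(p·)` of a bounded function `f ∈ ℓ∞(P)`. -/
def shiftInfty {P : Type*} [Monoid P] (p : P) (f : lp (fun _ : P => ℝ) ∞) :
    lp (fun _ : P => ℝ) ∞ :=
  ⟨fun q => f (p * q), by
    apply memℓp_infty
    exact BddAbove.mono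
      (Set.range_comp_subset_range (fun q : P => p * q) (fun q : P => ‖f q‖))
      (memℓp_infty_iff.mp (lp.memℓp f))⟩

section PositiveFunctional

variable {A : Type*} [CStarAlgebra A] [PartialOrder A] [StarOrderedRing A]

/-- Cauchy–Schwarz in the degenerate case: the null vectors of a positive functional are orthogonal
to everything. -/
lemma map_star_mul_add_star_mul_eq_zero {φ : A →ₗ[ℝ] ℝ} (hφ : ∀ a, 0 ≤ a → 0 ≤ φ a) {k : A}
    (hk : φ (star k * k) = 0) (t : A) : φ (star k * t + star t * k) = 0 := by
  have key (s : ℝ) : 0 ≤ φ (star t * t) + s * φ (star k * t + star t * k) := by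
    have h := hφ _ (star_mul_self_nonneg (t + s • k))
    have e : star (t + s • k) * (t + s • k) =
        star t * t + s • (star k * t + star t * k) + (s * s) • (star k * k) := by
      simp only [star_add, star_smul, star_trivial, add_mul, mul_add, smul_mul_assoc,
        mul_smul_comm, smul_add, smul_smul]
      abel
    rw [e, map_add, map_add, map_smul, map_smul, hk] at h
    simpa using h
  by_contra hne
  set b := φ (star k * t + star t * k)
  have h := key (-(φ (star t * t) + 1) / b)
  rw [div_mul_cancel₀ _ hne] at h
  linarith

/-- If `w - 1` is a null vector of a positive functional, then conjugation by `w` preserves its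
values on self-adjoint elements. -/
lemma map_star_mul_mul_eq {φ : A →ₗ[ℝ] ℝ} (hφ : ∀ a, 0 ≤ a → 0 ≤ φ a) {w : A}
    (hw : φ (star (w - 1) * (w - 1)) = 0) {m : A} (hm : IsSelfAdjoint m) :
    φ (star w * m * w) = φ m := by
  obtain ⟨k, rfl⟩ : ∃ k, w = 1 + k := ⟨w - 1, (add_sub_cancel 1 w).symm⟩
  rw [add_sub_cancel_left] at hw
  have h₁ := map_star_mul_add_star_mul_eq_zero hφ hw m
  have h₂ := map_star_mul_add_star_mul_eq_zero hφ hw (m * k)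
  rw [hm.star_eq] at h₁
  rw [star_mul, hm.star_eq, ← mul_assoc, map_add] at h₂
  have e : star (1 + k) * m * (1 + k) = m + (star k * m + m * k) + star k * m * k := by
    simp only [star_add, star_one, add_mul, mul_add, one_mul, mul_one]
    abel
  rw [e, map_add, map_add, h₁]
  linarith

/-- A contractive functional with value `1` at `1` has positive real part. -/
lemma re_apply_nonneg {g : StrongDual ℂ A} (hg : ‖g‖ ≤ 1) (hg1 : g 1 = 1) {a : A} (ha : 0 ≤ a) :
    0 ≤ (g a).re := by
  have hr : algebraMap ℝ A ‖a‖ - a ∈ Set.Icc 0 (algebraMap ℝ A ‖a‖) :=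
    ⟨sub_nonneg.2 (IsSelfAdjoint.of_nonneg ha).le_algebraMap_norm_self, sub_le_self _ ha⟩
  have hn := ((CStarAlgebra.mem_Icc_algebraMap_iff_norm_le (norm_nonneg a)).1 hr).2
  have hle : (g (algebraMap ℝ A ‖a‖ - a)).re ≤ ‖a‖ :=
    (Complex.re_le_norm _).trans ((g.le_of_opNorm_le hg _).trans ((one_mul _).trans_le hn))
  have e : g (algebraMap ℝ A ‖a‖) = ‖a‖ := by
    rw [Algebra.algebraMap_eq_smul_one, ← Complex.coe_smul, map_smul, hg1]
    simp
  rw [map_sub, e, Complex.sub_re, Complex.ofReal_re] at hle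
  linarith

/-- A character of a closed star subalgebra extends to a positive real functional. -/
lemma exists_positive_extension (S : StarSubalgebra ℂ A) (hS : IsClosed (S : Set A))
    (χ : S →⋆ₐ[ℂ] ℂ) :
    ∃ φ : A →ₗ[ℝ] ℝ, (∀ a, 0 ≤ a → 0 ≤ φ a) ∧ ∀ s : S, φ s = (χ s).re := by
  have : IsClosed (S : Set A) := hS
  let f : StrongDual ℂ (Subalgebra.toSubmodule S.toSubalgebra) :=
    LinearMap.mkContinuous (χ : S →ₗ[ℂ] ℂ) 1 fun s => by
      rw [one_mul]
      exact NonUnitalStarAlgHom.norm_apply_le (A := S) χ s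
  obtain ⟨g, hgf, hg⟩ := exists_extension_norm_eq _ f
  have hgχ (s : S) : g s = χ s := hgf s
  have hg1 : g 1 = 1 := by simpa using hgχ 1
  refine ⟨Complex.reLm ∘ₗ (g : A →ₗ[ℂ] ℂ).restrictScalars ℝ, fun a ha => ?_, fun s => ?_⟩
  · exact re_apply_nonneg (hg.trans_le (LinearMap.mkContinuous_norm_le _ zero_le_one _)) hg1 ha
  · exact congrArg Complex.re (hgχ s)

/-- An extended character `φ` satisfies `φ (v⋆ m v) = φ m` for isometries `v` in its multiplicative
domain. -/
lemma exists_positive_functional_of_character (S : StarSubalgebra ℂ A) (hS : IsClosed (S : Set A))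
    (χ : S →⋆ₐ[ℂ] ℂ) :
    ∃ φ : A →ₗ[ℝ] ℝ, (∀ a, 0 ≤ a → 0 ≤ φ a) ∧ φ 1 = 1 ∧
      ∀ v ∈ S, star v * v = 1 → ∀ m n, IsSelfAdjoint m → m * v = v * n → φ n = φ m := by
  obtain ⟨φ, hφ, hφχ⟩ := exists_positive_extension S hS χ
  refine ⟨φ, hφ, by simpa using hφχ 1, fun v hv hvv m n hm hmn => ?_⟩
  lift v to S using hv
  have hχv : star (χ v) * χ v = 1 := by
    rw [← map_star, ← map_mul, show star v * v = 1 from Subtype.ext hvv, map_one]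
  have hnull := hφχ (star (star (χ v) • v - 1) * (star (χ v) • v - 1))
  have hχw : χ (star (χ v) • v - 1) = 0 := by
    rw [map_sub, map_smul, map_one, smul_eq_mul, hχv, sub_self]
  rw [map_mul, hχw, mul_zero, Complex.zero_re] at hnull
  have h := map_star_mul_mul_eq hφ (w := star (χ v) • (v : A)) hnull hm
  rw [← h, star_smul, star_star, mul_assoc, mul_smul_comm, hmn, smul_mul_smul_comm,
    mul_comm (χ v), hχv, one_smul, ← mul_assoc, hvv, one_mul]

end PositiveFunctional

section Multiplication

variable {P : Type*}

local notation "ℓ²" P => lp (fun _ : P => ℂ) 2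

/-- Multiplication by a bounded real function, as an operator on `ℓ²`. -/
def mulOp : lp (fun _ : P => ℝ) ∞ →ₗ[ℝ] ((ℓ² P) →L[ℂ] (ℓ² P)) where
  toFun f := lp.mapCLM 2 (fun q => (f q : ℂ) • ContinuousLinearMap.id ℂ ℂ) (norm_nonneg f)
    fun q => by
      rw [norm_smul, ContinuousLinearMap.norm_id, mul_one, Complex.norm_real]
      exact lp.norm_apply_le_norm ENNReal.top_ne_zero f q
  map_add' f g := by
    ext x q
    simp [add_mul]
  map_smul' c f := by
    ext x q
    simp [mul_assoc]

@[simp]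
lemma mulOp_apply (f : lp (fun _ : P => ℝ) ∞) (x : ℓ² P) (q : P) : mulOp f x q = f q * x q := by
  simp [mulOp]

lemma mulOp_one : mulOp (1 : lp (fun _ : P => ℝ) ∞) = 1 := by
  ext x q
  simp

lemma mulOp_single [DecidableEq P] (f : lp (fun _ : P => ℝ) ∞) (q : P) :
    mulOp f (lp.single 2 q (1 : ℂ)) = (f q : ℂ) • lp.single 2 q (1 : ℂ) := by
  ext r
  rw [mulOp_apply, lp.coeFn_smul, Pi.smul_apply, smul_eq_mul]
  obtain rfl | h := eq_or_ne r q
  · rfl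
  · rw [lp.single_apply_ne _ _ _ h, mul_zero, mul_zero]

lemma inner_mulOp_left (f : lp (fun _ : P => ℝ) ∞) (x y : ℓ² P) :
    inner ℂ (mulOp f x) y = inner ℂ x (mulOp f y) := by
  rw [lp.inner_eq_tsum, lp.inner_eq_tsum]
  refine tsum_congr fun q => ?_
  simp only [mulOp_apply, RCLike.inner_apply, map_mul, Complex.conj_ofReal]
  ring

lemma isSelfAdjoint_mulOp (f : lp (fun _ : P => ℝ) ∞) : IsSelfAdjoint (mulOp f) :=
  ContinuousLinearMap.isSelfAdjoint_iff_isSymmetric.2 (inner_mulOp_left f)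

lemma mulOp_nonneg {f : lp (fun _ : P => ℝ) ∞} (hf : ∀ q, 0 ≤ f q) : 0 ≤ mulOp f := by
  refine (ContinuousLinearMap.nonneg_iff_isPositive _).2 ⟨inner_mulOp_left f, fun x => ?_⟩
  have h := (lp.hasSum_inner (𝕜 := ℂ) (mulOp f x) x).mapL Complex.reCLM
  refine h.nonneg fun q => ?_
  have e : inner ℂ (mulOp f x q) (x q) = ((f q * ‖x q‖ ^ 2 : ℝ) : ℂ) := by
    rw [mulOp_apply, RCLike.inner_apply, map_mul, Complex.conj_ofReal, mul_left_comm,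
      Complex.mul_conj']
    push_cast
    rfl
  rw [e, Complex.reCLM_apply, Complex.ofReal_re]
  exact mul_nonneg (hf q) (sq_nonneg _)

variable [DecidableEq P]

/-- Operators on `ℓ²` are determined by their values on the standard basis. -/
lemma clm_ext_single {S T : (ℓ² P) →L[ℂ] (ℓ² P)}
    (h : ∀ q, S (lp.single 2 q (1 : ℂ)) = T (lp.single 2 q (1 : ℂ))) : S = T := by
  refine ContinuousLinearMap.ext fun x => ?_
  have hx := lp.hasSum_single ENNReal.ofNat_ne_top x
  refine (hx.mapL S).unique ?_
  convert hx.mapL T using 2 with q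
  have e : (lp.single 2 q (x q) : ℓ² P) = x q • lp.single 2 q (1 : ℂ) := by
    rw [← lp.single_smul (E := fun _ : P => ℂ), smul_eq_mul, mul_one]
  rw [e, map_smul, map_smul, h]

variable [Monoid P] {p : P} {T : (ℓ² P) →L[ℂ] (ℓ² P)}

lemma star_mul_self_of_shift (hp : ∀ x y, p * x = p * y → x = y)
    (hT : ∀ x, T (lp.single 2 x (1 : ℂ)) = lp.single 2 (p * x) (1 : ℂ)) : star T * T = 1 := by
  refine clm_ext_single fun x => ?_
  ext y
  have h := lp.inner_single_left (𝕜 := ℂ) y (1 : ℂ) ((star T * T) (lp.single 2 x (1 : ℂ)))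
  rw [RCLike.inner_apply, map_one, mul_one] at h
  rw [← h, mul_apply_eq_comp, ContinuousLinearMap.star_eq_adjoint,
    ContinuousLinearMap.adjoint_inner_right, hT, hT, lp.inner_single_left,
    one_apply_eq_self, RCLike.inner_apply, map_one, mul_one]
  obtain rfl | hne := eq_or_ne y x
  · rw [lp.single_apply_self, lp.single_apply_self]
  · rw [lp.single_apply_ne _ _ _ hne, lp.single_apply_ne _ _ _ fun h => hne (hp _ _ h)]

lemma mulOp_mul_shift (hT : ∀ x, T (lp.single 2 x (1 : ℂ)) = lp.single 2 (p * x) (1 : ℂ))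
    (f : lp (fun _ : P => ℝ) ∞) : mulOp f * T = T * mulOp (shiftInfty p f) := by
  refine clm_ext_single fun x => ?_
  rw [mul_apply_eq_comp, mul_apply_eq_comp, hT, mulOp_single,
    mulOp_single, map_smul, hT]
  rfl

end Multiplication

/-- If there is a nonzero character (unital *-homomorphism to `ℂ`) on the
reduced semigroup C*-algebra `C*_r(P)` (the C*-subalgebra of `B(ℓ²(P))` generated by the
isometries `V_p`), then `P` is left amenable, i.e. there is a left invariant mean on
`ℓ∞(P)`. -/
theorem stmt_16 {P : Type*} [Monoid P] [DecidableEq P]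
    (hcancel : ∀ p x y : P, p * x = p * y → x = y)
    (V : P → (lp (fun _ : P => ℂ) 2 →L[ℂ] lp (fun _ : P => ℂ) 2))
    (hV : ∀ p x : P, V p (lp.single 2 x (1 : ℂ)) = lp.single 2 (p * x) (1 : ℂ))
    (χ : ((StarAlgebra.adjoin ℂ (Set.range V)).topologicalClosure) →⋆ₐ[ℂ] ℂ) :
    ∃ μ : lp (fun _ : P => ℝ) ∞ →ₗ[ℝ] ℝ,
      (∀ f, (∀ q, 0 ≤ f q) → 0 ≤ μ f) ∧ μ 1 = 1 ∧
      (∀ (p : P) (f : lp (fun _ : P => ℝ) ∞), μ (shiftInfty p f) = μ f) := by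
  obtain ⟨φ, hφ, hφ1, hφV⟩ := exists_positive_functional_of_character _
    (StarSubalgebra.isClosed_topologicalClosure _) χ
  let μ : lp (fun _ : P => ℝ) ∞ →ₗ[ℝ] ℝ :=
    { toFun f := φ (mulOp f)
      map_add' f g := (congrArg φ (map_add mulOp f g)).trans (map_add φ _ _)
      map_smul' c f := (congrArg φ (map_smul mulOp c f)).trans (map_smul φ c _) }
  refine ⟨μ, fun f hf => hφ _ (mulOp_nonneg hf), (congrArg φ mulOp_one).trans hφ1, fun p f => ?_⟩
  exact hφV (V p)
    (StarSubalgebra.le_topologicalClosure _ (StarAlgebra.subset_adjoin _ _ ⟨p, rfl⟩))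
    (star_mul_self_of_shift (hcancel p) (hV p)) _ _ (isSelfAdjoint_mulOp f)
    (mulOp_mul_shift (hV p) f)
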